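/- arXiv:1608.08997 — 2 statements merged into one kernel-verified Lean document; each statement's English description precedes it below -/
import Mathlib

section
/- Let K > 0 and let H : ℝ^N × ℝ × ℝ^N × [0,T] → ℝ satisfy |H(p,u,x,t)| ≤ K(1 + |u| + |p|) and |H(p,u,x,t) − H(p̄,ū,x,t)| ≤ K(|u − ū| + |p − p̄|) for all arguments, and let β : ℝ^N → ℝ be bounded and Lipschitz. Let Γ be a measurable kernel Γ(x,t,y,s) ≥ 0 defined for x,y ∈ ℝ^N and 0 ≤ t < s ≤ T such that ∫_{ℝ^N} Γ(x,t,y,s) dy = 1 for all x, t < s, and such that there are constants C, c > 0 with |D_x Γ(x,t,y,s)| ≤ C (s−t)^{−(N+1)/2} exp(−c|y−x|²/(s−t)). Define the operator T on C_b^{1,0} by (Tu)(x,t) := ∫_{ℝ^N} β(y) Γ(x,t,y,T) dy + ∫_t^T ∫_{ℝ^N} H(D_x u(y,s), u(y,s), y, s) Γ(x,t,y,s) dy ds, and assume that for every u ∈ C_b^{1,0} the function Tu again belongs to C_b^{1,0} with spatial gradient D_x(Tu)(x,t) = ∫_{ℝ^N} β(y) D_x Γ(x,t,y,T) dy + ∫_t^T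 ∫_{ℝ^N} H(D_x u(y,s), u(y,s), y, s) D_x Γ(x,t,y,s) dy ds. Then there exists κ > 0 such that T is a contraction with respect to ‖·‖_κ: for all u, v ∈ C_b^{1,0}, ‖Tu − Tv‖_κ ≤ (1/2)‖u − v‖_κ. -/
open scoped BigOperators
open MeasureTheory Set Filter

noncomputable section

abbrev Euc (N : ℕ) : Type := EuclideanSpace ℝ (Fin N)

/-- Membership in `C_b^{1,0}`: `u : ℝ^N × [0,T] → ℝ` is continuous and bounded,
its spatial gradient `Du` exists everywhere, and `Du` is continuous and
bounded. -/
def MemCb10 (N : ℕ) (T : ℝ) (u : Euc N → ℝ → ℝ) (Du : Euc N → ℝ → Euc N) : Prop :=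
  ContinuousOn (fun q : Euc N × ℝ => u q.1 q.2) (Set.univ ×ˢ Set.Icc 0 T)
  ∧ (∀ x t, t ∈ Set.Icc (0:ℝ) T → HasGradientAt (fun y => u y t) (Du x t) x)
  ∧ ContinuousOn (fun q : Euc N × ℝ => Du q.1 q.2) (Set.univ ×ˢ Set.Icc 0 T)
  ∧ (∃ C, ∀ x t, t ∈ Set.Icc (0:ℝ) T → |u x t| ≤ C ∧ ‖Du x t‖ ≤ C)

/-- The weighted norm
`‖u‖_κ = sup e^{−κ(T−t)}|u(x,t)| + sup e^{−κ(T−t)}‖D_x u(x,t)‖`. -/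
def normK (N : ℕ) (T κ : ℝ) (u : Euc N → ℝ → ℝ) (Du : Euc N → ℝ → Euc N) : ℝ :=
  (⨆ q : Euc N × (Set.Icc (0:ℝ) T), Real.exp (-κ * (T - (q.2 : ℝ))) * |u q.1 (q.2 : ℝ)|)
  + (⨆ q : Euc N × (Set.Icc (0:ℝ) T), Real.exp (-κ * (T - (q.2 : ℝ))) * ‖Du q.1 (q.2 : ℝ)‖)

/-- The fixed point operator
`(Tu)(x,t) = ∫ β(y) Γ(x,t,y,T) dy + ∫_t^T ∫ H(D_x u(y,s), u(y,s), y, s) Γ(x,t,y,s) dy ds`. -/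
def Tmap (N : ℕ) (T : ℝ) (β : Euc N → ℝ)
    (Γk : Euc N → ℝ → Euc N → ℝ → ℝ)
    (H : Euc N → ℝ → Euc N → ℝ → ℝ)
    (u : Euc N → ℝ → ℝ) (Du : Euc N → ℝ → Euc N)
    (x : Euc N) (t : ℝ) : ℝ :=
  (∫ y : Euc N, β y * Γk x t y T)
    + ∫ s in Set.Ioc t T, ∫ y : Euc N, H (Du y s) (u y s) y s * Γk x t y s

/-- The formula for the spatial gradient of `Tu`, built from the spatial
gradient `DΓ` of the kernel. -/
def DTmap (N : ℕ) (T : ℝ) (β : Euc N → ℝ)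
    (DΓ : Euc N → ℝ → Euc N → ℝ → Euc N)
    (H : Euc N → ℝ → Euc N → ℝ → ℝ)
    (u : Euc N → ℝ → ℝ) (Du : Euc N → ℝ → Euc N)
    (x : Euc N) (t : ℝ) : Euc N :=
  (∫ y : Euc N, β y • DΓ x t y T)
    + ∫ s in Set.Ioc t T, ∫ y : Euc N, H (Du y s) (u y s) y s • DΓ x t y s

lemma setIntegral_Ioi_rpow_mul_exp {a κ : ℝ} (ha : 0 < a) (hκ : 0 < κ) (t : ℝ) :
    ∫ s in Ioi t, (s - t) ^ (a - 1) * Real.exp (-(κ * (s - t))) =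
      (1 / κ) ^ a * Real.Gamma a := by
  rw [← Real.integral_rpow_mul_exp_neg_mul_Ioi ha hκ]
  have h := (measurePreserving_sub_right volume t).setIntegral_preimage_emb
    (MeasurableEquiv.subRight t).measurableEmbedding
    (fun r : ℝ => r ^ (a - 1) * Real.exp (-(κ * r))) (Ioi 0)
  simpa using h

lemma integrableOn_Ioi_rpow_mul_exp {a κ : ℝ} (ha : 0 < a) (hκ : 0 < κ) (t : ℝ) :
    IntegrableOn (fun s => (s - t) ^ (a - 1) * Real.exp (-(κ * (s - t)))) (Ioi t) := by
  refine Integrable.of_integral_ne_zero ?_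
  rw [setIntegral_Ioi_rpow_mul_exp ha hκ]
  have := Real.Gamma_pos_of_pos ha
  positivity

/-- Weighted bound for a parabolic potential whose kernel has spatial mass at most
`A (s - t) ^ (a - 1)`. -/
lemma potential_integrable_and_norm_le {X E : Type*} [MeasurableSpace X] [NormedAddCommGroup E]
    [NormedSpace ℝ E] {μ : Measure X} [SFinite μ]
    {a κ A L t T : ℝ} (ha : 0 < a) (hκ : 0 < κ) (hA : 0 ≤ A) (hL : 0 ≤ L)
    {f : X → ℝ → ℝ} {k : X → ℝ → E}
    (hf : StronglyMeasurable fun q : X × Ioc t T => f q.1 q.2)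
    (hk : StronglyMeasurable fun q : X × Ioc t T => k q.1 q.2)
    (hki : ∀ s ∈ Ioc t T, Integrable (k · s) μ)
    (hkA : ∀ s ∈ Ioc t T, ∫ y, ‖k y s‖ ∂μ ≤ A * (s - t) ^ (a - 1))
    (hfL : ∀ y, ∀ s ∈ Ioc t T, |f y s| ≤ L * Real.exp (κ * (T - s))) :
    (∀ s ∈ Ioc t T, Integrable (fun y => f y s • k y s) μ) ∧
    IntegrableOn (fun s => ∫ y, f y s • k y s ∂μ) (Ioc t T) ∧
    ‖∫ s in Ioc t T, ∫ y, f y s • k y s ∂μ‖ ≤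
      L * A * ((1 / κ) ^ a * Real.Gamma a) * Real.exp (κ * (T - t)) := by
  have hfib : ∀ s ∈ Ioc t T, Integrable (fun y => f y s • k y s) μ := fun s hs =>
    (hki s hs).bdd_smul (C := L * Real.exp (κ * (T - s)))
      (hφ1 := (hf.comp_measurable (measurable_prodMk_right (y := (⟨s, hs⟩ : Ioc t T)))).aestronglyMeasurable)
      (hφ2 := Eventually.of_forall fun y => hfL y s hs)
  have hmeas : AEStronglyMeasurable (fun s => ∫ y, f y s • k y s ∂μ)
      (volume.restrict (Ioc t T)) := by
    rw [← map_comap_subtype_coe measurableSet_Ioc,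
      (MeasurableEmbedding.subtype_coe measurableSet_Ioc).aestronglyMeasurable_map_iff]
    exact (hf.smul hk).integral_prod_left'.aestronglyMeasurable
  have hbound : ∀ s ∈ Ioc t T, ‖∫ y, f y s • k y s ∂μ‖ ≤
      L * A * Real.exp (κ * (T - t)) * ((s - t) ^ (a - 1) * Real.exp (-(κ * (s - t)))) := by
    intro s hs
    calc ‖∫ y, f y s • k y s ∂μ‖ ≤ ∫ y, L * Real.exp (κ * (T - s)) * ‖k y s‖ ∂μ := by
          refine norm_integral_le_of_norm_le ((hki s hs).norm.const_mul _)
            (Eventually.of_forall fun y => ?_)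
          rw [norm_smul]
          exact mul_le_mul_of_nonneg_right (hfL y s hs) (norm_nonneg _)
      _ ≤ L * Real.exp (κ * (T - s)) * (A * (s - t) ^ (a - 1)) := by
          rw [integral_const_mul]
          exact mul_le_mul_of_nonneg_left (hkA s hs) (by positivity)
      _ = _ := by
          have : κ * (T - s) = κ * (T - t) + -(κ * (s - t)) := by ring
          rw [this, Real.exp_add]
          ring
  have hdomI := (integrableOn_Ioi_rpow_mul_exp ha hκ t).const_mul
    (L * A * Real.exp (κ * (T - t)))
  have hdom := IntegrableOn.mono_set hdomI (Ioc_subset_Ioi_self : Ioc t T ⊆ Ioi t)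
  have hae := (ae_restrict_mem (μ := volume) (measurableSet_Ioc (a := t) (b := T))).mono hbound
  refine ⟨hfib, hdom.mono' hmeas hae, (norm_integral_le_of_norm_le hdom hae).trans ?_⟩
  refine (setIntegral_mono_set hdomI ?_ Ioc_subset_Ioi_self.eventuallyLE).trans_eq ?_
  · filter_upwards [ae_restrict_mem measurableSet_Ioi] with s hs
    have : 0 ≤ s - t := sub_nonneg.2 (le_of_lt hs)
    simp only [Pi.zero_apply]
    positivity
  · rw [integral_const_mul, setIntegral_Ioi_rpow_mul_exp ha hκ]
    ring

lemma norm_potential_sub_le {X E : Type*} [MeasurableSpace X] [NormedAddCommGroup E]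
    [NormedSpace ℝ E] {μ : Measure X} [SFinite μ]
    {a κ A L B t T : ℝ} (ha : 0 < a) (hκ : 0 < κ) (hA : 0 ≤ A) (hL : 0 ≤ L) (hB : 0 ≤ B)
    {f g : X → ℝ → ℝ} {k : X → ℝ → E}
    (hf : StronglyMeasurable fun q : X × Ioc t T => f q.1 q.2)
    (hg : StronglyMeasurable fun q : X × Ioc t T => g q.1 q.2)
    (hk : StronglyMeasurable fun q : X × Ioc t T => k q.1 q.2)
    (hki : ∀ s ∈ Ioc t T, Integrable (k · s) μ)
    (hkA : ∀ s ∈ Ioc t T, ∫ y, ‖k y s‖ ∂μ ≤ A * (s - t) ^ (a - 1))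
    (hfB : ∀ y, ∀ s ∈ Ioc t T, |f y s| ≤ B)
    (hgB : ∀ y, ∀ s ∈ Ioc t T, |g y s| ≤ B)
    (hfg : ∀ y, ∀ s ∈ Ioc t T, |f y s - g y s| ≤ L * Real.exp (κ * (T - s))) :
    ‖(∫ s in Ioc t T, ∫ y, f y s • k y s ∂μ) - ∫ s in Ioc t T, ∫ y, g y s • k y s ∂μ‖ ≤
      L * A * ((1 / κ) ^ a * Real.Gamma a) * Real.exp (κ * (T - t)) := by
  have hexp : ∀ s ∈ Ioc t T, B ≤ B * Real.exp (κ * (T - s)) := fun s hs =>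
    le_mul_of_one_le_right hB
      (Real.one_le_exp (mul_nonneg hκ.le (sub_nonneg.2 hs.2)))
  obtain ⟨hf1, hf2, -⟩ := potential_integrable_and_norm_le (μ := μ) ha hκ hA hB hf hk hki hkA
    fun y s hs => (hfB y s hs).trans (hexp s hs)
  obtain ⟨hg1, hg2, -⟩ := potential_integrable_and_norm_le (μ := μ) ha hκ hA hB hg hk hki hkA
    fun y s hs => (hgB y s hs).trans (hexp s hs)
  obtain ⟨-, -, h⟩ := potential_integrable_and_norm_le (μ := μ) (f := fun y s => f y s - g y s)
    ha hκ hA hL (hf.sub hg) hk hki hkA hfg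
  rw [← integral_sub hf2 hg2]
  convert h using 2
  refine setIntegral_congr_fun measurableSet_Ioc fun s hs => ?_
  simp only [sub_smul]
  exact (integral_sub (hf1 s hs) (hg1 s hs)).symm

lemma measurable_gradient_of_forall_hasGradientAt {N : ℕ} {α : Type*} [MeasurableSpace α]
    {F : Euc N → α → ℝ} (hF : ∀ x, Measurable (F x)) {x : Euc N} {G : α → Euc N}
    (hG : ∀ q, HasGradientAt (fun x' => F x' q) (G q) x) : Measurable G := by
  have hcoord : ∀ v : Euc N, Measurable fun q => inner ℝ (G q) v := by
    intro v
    refine measurable_of_tendsto_metrizable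
      (f := fun (n : ℕ) q => (n : ℝ) • (F (x + (n : ℝ)⁻¹ • v) q - F x q)) (fun n => ?_) ?_
    · exact ((hF _).sub (hF _)).const_mul _
    · refine tendsto_pi_nhds.2 fun q => ?_
      exact (hG q).hasFDerivAt.lim v (by simpa using tendsto_natCast_atTop_atTop)
  have hsum : G = fun q => ∑ i, inner ℝ (G q) (EuclideanSpace.basisFun (Fin N) ℝ i) •
      EuclideanSpace.basisFun (Fin N) ℝ i := by
    funext q
    conv_lhs => rw [← (EuclideanSpace.basisFun (Fin N) ℝ).sum_repr' (G q)]
    simp only [real_inner_comm]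
  rw [hsum]
  exact Finset.measurable_sum _ fun i _ => (hcoord _).smul_const _

lemma integrable_exp_neg_mul_sq_norm_sub {N : ℕ} {b : ℝ} (hb : 0 < b) (x : Euc N) :
    Integrable fun y : Euc N => Real.exp (-b * ‖y - x‖ ^ 2) := by
  refine Integrable.of_integral_ne_zero ?_
  rw [integral_sub_right_eq_self (fun z : Euc N => Real.exp (-b * ‖z‖ ^ 2)) x,
    GaussianFourier.integral_rexp_neg_mul_sq_norm hb]
  positivity

lemma integral_exp_neg_mul_sq_norm_sub {N : ℕ} {b : ℝ} (hb : 0 < b) (x : Euc N) :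
    ∫ y : Euc N, Real.exp (-b * ‖y - x‖ ^ 2) = (Real.pi / b) ^ ((N : ℝ) / 2) := by
  rw [integral_sub_right_eq_self (fun z : Euc N => Real.exp (-b * ‖z‖ ^ 2)) x,
    GaussianFourier.integral_rexp_neg_mul_sq_norm hb, finrank_euclideanSpace_fin]

lemma integrable_and_integral_norm_le_of_gaussian_bound {N : ℕ} {E : Type*}
    [NormedAddCommGroup E] {C c r : ℝ} (hc : 0 < c)
    (hr : 0 < r) {x : Euc N} {k : Euc N → E} (hk : AEStronglyMeasurable k)
    (hbound : ∀ y, ‖k y‖ ≤ C * r ^ (-(((N : ℝ) + 1) / 2)) * Real.exp (-c * ‖y - x‖ ^ 2 / r)) :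
    Integrable k ∧
      ∫ y, ‖k y‖ ≤ C * (Real.pi / c) ^ ((N : ℝ) / 2) * r ^ ((1 / 2 : ℝ) - 1) := by
  have hcr : 0 < c / r := div_pos hc hr
  have hb : ∀ y, ‖k y‖ ≤
      C * r ^ (-(((N : ℝ) + 1) / 2)) * Real.exp (-(c / r) * ‖y - x‖ ^ 2) := fun y => by
    convert hbound y using 3
    ring
  have hI := (integrable_exp_neg_mul_sq_norm_sub hcr x).const_mul
    (C * r ^ (-(((N : ℝ) + 1) / 2)))
  have hkI : Integrable k := hI.mono' hk (Eventually.of_forall hb)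
  refine ⟨hkI, (integral_mono hkI.norm hI hb).trans_eq ?_⟩
  rw [integral_const_mul, integral_exp_neg_mul_sq_norm_sub hcr,
    show Real.pi / (c / r) = Real.pi / c * r by field_simp,
    Real.mul_rpow (by positivity) hr.le,
    show (1 / 2 : ℝ) - 1 = -(((N : ℝ) + 1) / 2) + (N : ℝ) / 2 by ring, Real.rpow_add hr]
  ring

lemma exp_mul_norm_le_iSup {N : ℕ} {T κ : ℝ} {E : Type*} [NormedAddCommGroup E]
    {w : Euc N → ℝ → E} {B : ℝ} (hκ : 0 ≤ κ)
    (hB : ∀ x t, t ∈ Icc (0 : ℝ) T → ‖w x t‖ ≤ B) (x : Euc N) (t : Icc (0 : ℝ) T) :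
    Real.exp (-κ * (T - (t : ℝ))) * ‖w x t‖ ≤
      ⨆ q : Euc N × (Icc (0 : ℝ) T), Real.exp (-κ * (T - (q.2 : ℝ))) * ‖w q.1 q.2‖ := by
  refine le_ciSup (f := fun q : Euc N × (Icc (0 : ℝ) T) =>
    Real.exp (-κ * (T - (q.2 : ℝ))) * ‖w q.1 q.2‖) ⟨B, ?_⟩ (x, t)
  rintro _ ⟨q, rfl⟩
  refine le_trans (mul_le_of_le_one_left (norm_nonneg _) (Real.exp_le_one_iff.2 ?_))
    (hB _ _ q.2.2)
  rw [neg_mul]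
  exact neg_nonpos.2 (mul_nonneg hκ (sub_nonneg.2 q.2.2.2))

lemma exists_pos_mul_rpow_add_le_half {P Q : ℝ} :
    ∃ κ : ℝ, 0 < κ ∧ P * (1 / κ) ^ (1 : ℝ) + Q * (1 / κ) ^ (1 / 2 : ℝ) ≤ 1 / 2 := by
  have h1 : ∀ a : ℝ, 0 < a → Tendsto (fun κ : ℝ => (1 / κ) ^ a) atTop (nhds 0) := by
    intro a ha
    refine (tendsto_rpow_neg_atTop ha).congr' ?_
    filter_upwards [eventually_gt_atTop 0] with κ hκ
    rw [one_div, Real.inv_rpow hκ.le, Real.rpow_neg hκ.le]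
  have h := ((h1 1 one_pos).const_mul P).add ((h1 (1 / 2) one_half_pos).const_mul Q)
  simp only [mul_zero, add_zero] at h
  obtain ⟨κ, h2, h3⟩ := ((h.eventually_le_const one_half_pos).and (eventually_gt_atTop 0)).exists
  exact ⟨κ, h3, h2⟩

lemma MemCb10.stronglyMeasurable_comp {N : ℕ} {T t : ℝ} (ht : 0 ≤ t)
    {H : Euc N → ℝ → Euc N → ℝ → ℝ}
    (hH : Measurable (fun q : (Euc N × ℝ) × (Euc N × ℝ) => H q.1.1 q.1.2 q.2.1 q.2.2))
    {u : Euc N → ℝ → ℝ} {Du : Euc N → ℝ → Euc N} (hu : MemCb10 N T u Du) :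
    StronglyMeasurable fun q : Euc N × Ioc t T => H (Du q.1 q.2) (u q.1 q.2) q.1 q.2 := by
  have hc : Continuous fun q : Euc N × Ioc t T => (q.1, (q.2 : ℝ)) := by fun_prop
  have hmem : ∀ q : Euc N × Ioc t T, (q.1, (q.2 : ℝ)) ∈ (univ : Set (Euc N)) ×ˢ Icc (0 : ℝ) T :=
    fun q => ⟨mem_univ _, ht.trans q.2.2.1.le, q.2.2.2⟩
  have h1 := (hu.1.comp_continuous hc hmem).measurable
  have h2 := (hu.2.2.1.comp_continuous hc hmem).measurable
  exact (hH.comp ((h2.prodMk h1).prodMk hc.measurable)).stronglyMeasurable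

/-- the fixed-point operator built from the fundamental solution
is a contraction in the weighted norm `‖·‖_κ` for `κ` large enough. -/
theorem contraction_fixed_point_operator
    (N : ℕ) (hN : 1 ≤ N) (T : ℝ) (hT : 0 < T)
    (K : ℝ) (hK : 0 < K)
    (H : Euc N → ℝ → Euc N → ℝ → ℝ)
    (hHmeas : Measurable
      (fun q : (Euc N × ℝ) × (Euc N × ℝ) => H q.1.1 q.1.2 q.2.1 q.2.2))
    (hHgrowth : ∀ (p : Euc N) (v : ℝ) (x : Euc N) (t : ℝ),
        |H p v x t| ≤ K * (1 + |v| + ‖p‖))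
    (hHlip : ∀ (p p' : Euc N) (v v' : ℝ) (x : Euc N) (t : ℝ),
        |H p v x t - H p' v' x t| ≤ K * (|v - v'| + ‖p - p'‖))
    (β : Euc N → ℝ)
    (hβbdd : ∃ C, ∀ x, |β x| ≤ C)
    (hβLip : ∃ L, ∀ x y : Euc N, |β x - β y| ≤ L * ‖x - y‖)
    (Γk : Euc N → ℝ → Euc N → ℝ → ℝ)
    (hΓmeas : Measurable
      (fun q : (Euc N × ℝ) × (Euc N × ℝ) => Γk q.1.1 q.1.2 q.2.1 q.2.2))
    (hΓnonneg : ∀ (x y : Euc N) (t s : ℝ), 0 ≤ t → t < s → s ≤ T →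
        0 ≤ Γk x t y s)
    (hΓmass : ∀ (x : Euc N) (t s : ℝ), 0 ≤ t → t < s → s ≤ T →
        (∫ y : Euc N, Γk x t y s) = 1)
    (DΓ : Euc N → ℝ → Euc N → ℝ → Euc N)
    (hDΓ : ∀ (x y : Euc N) (t s : ℝ), 0 ≤ t → t < s → s ≤ T →
        HasGradientAt (fun x' => Γk x' t y s) (DΓ x t y s) x)
    (C c : ℝ) (hC : 0 < C) (hc : 0 < c)
    (hDΓbound : ∀ (x y : Euc N) (t s : ℝ), 0 ≤ t → t < s → s ≤ T →
        ‖DΓ x t y s‖ ≤ C * (s - t) ^ (-(((N : ℝ) + 1) / 2))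
          * Real.exp (-c * ‖y - x‖ ^ 2 / (s - t)))
    (hTmapsCb : ∀ (u : Euc N → ℝ → ℝ) (Du : Euc N → ℝ → Euc N),
        MemCb10 N T u Du →
        MemCb10 N T (Tmap N T β Γk H u Du) (DTmap N T β DΓ H u Du)) :
    ∃ κ : ℝ, 0 < κ ∧
      ∀ (u v : Euc N → ℝ → ℝ) (Du Dv : Euc N → ℝ → Euc N),
        MemCb10 N T u Du → MemCb10 N T v Dv →
        normK N T κ
            (fun x t => Tmap N T β Γk H u Du x t - Tmap N T β Γk H v Dv x t)
            (fun x t => DTmap N T β DΓ H u Du x t - DTmap N T β DΓ H v Dv x t)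
          ≤ (1/2) * normK N T κ (fun x t => u x t - v x t)
              (fun x t => Du x t - Dv x t) := by
  set G : ℝ := (Real.pi / c) ^ ((N : ℝ) / 2)
  obtain ⟨κ, hκ, hκle⟩ := exists_pos_mul_rpow_add_le_half
    (P := K) (Q := K * (C * G) * Real.Gamma (1 / 2))
  refine ⟨κ, hκ, fun u v Du Dv hu hv => ?_⟩
  obtain ⟨Bu, hBu⟩ := hu.2.2.2
  obtain ⟨Bv, hBv⟩ := hv.2.2.2
  set M := normK N T κ (fun x t => u x t - v x t) (fun x t => Du x t - Dv x t) with hM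
  have hT' : (0 : ℝ) ∈ Icc (0 : ℝ) T := ⟨le_rfl, hT.le⟩
  have : Nonempty (Icc (0 : ℝ) T) := ⟨⟨0, hT'⟩⟩
  have hM0 : 0 ≤ M := add_nonneg (Real.iSup_nonneg fun q => by positivity)
    (Real.iSup_nonneg fun q => by positivity)
  have hdiff : ∀ y, ∀ s ∈ Icc (0 : ℝ) T,
      |u y s - v y s| + ‖Du y s - Dv y s‖ ≤ M * Real.exp (κ * (T - s)) := by
    intro y s hs
    have h1 := exp_mul_norm_le_iSup (w := fun x t => u x t - v x t) (B := Bu + Bv) hκ.le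
      (fun x t ht => (norm_sub_le _ _).trans (add_le_add (hBu x t ht).1 (hBv x t ht).1)) y ⟨s, hs⟩
    have h2 := exp_mul_norm_le_iSup (w := fun x t => Du x t - Dv x t) (B := Bu + Bv) hκ.le
      (fun x t ht => (norm_sub_le _ _).trans (add_le_add (hBu x t ht).2 (hBv x t ht).2)) y ⟨s, hs⟩
    have h3 := add_le_add h1 h2
    rw [← mul_add, neg_mul, Real.exp_neg, inv_mul_le_iff₀ (Real.exp_pos _), mul_comm] at h3
    exact h3
  set B := K * (1 + max Bu Bv + max Bu Bv) with hBdef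
  have hfu : ∀ y, ∀ s ∈ Icc (0 : ℝ) T, |H (Du y s) (u y s) y s| ≤ B := fun y s hs => by
    refine (hHgrowth _ _ _ _).trans ?_
    have := hBu y s hs
    rw [hBdef]
    gcongr
    · exact this.1.trans (le_max_left _ _)
    · exact this.2.trans (le_max_left _ _)
  have hfv : ∀ y, ∀ s ∈ Icc (0 : ℝ) T, |H (Dv y s) (v y s) y s| ≤ B := fun y s hs => by
    refine (hHgrowth _ _ _ _).trans ?_
    have := hBv y s hs
    rw [hBdef]
    gcongr
    · exact this.1.trans (le_max_right _ _)
    · exact this.2.trans (le_max_right _ _)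
  have hB0 : 0 ≤ B := (abs_nonneg _).trans (hfu 0 0 hT')
  have hfg : ∀ y, ∀ s ∈ Icc (0 : ℝ) T, |H (Du y s) (u y s) y s - H (Dv y s) (v y s) y s| ≤
      K * M * Real.exp (κ * (T - s)) := fun y s hs => by
    refine (hHlip _ _ _ _ _ _).trans ?_
    rw [mul_assoc]
    exact mul_le_mul_of_nonneg_left (hdiff y s hs) hK.le
  have hsub : ∀ {t}, 0 ≤ t → ∀ {s}, s ∈ Ioc t T → s ∈ Icc (0 : ℝ) T :=
    fun ht _ hs => ⟨ht.trans hs.1.le, hs.2⟩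
  have hKM : 0 ≤ K * M := mul_nonneg hK.le hM0
  have hunweight : ∀ {z D t : ℝ}, z ≤ D * Real.exp (κ * (T - t)) →
      Real.exp (-κ * (T - t)) * z ≤ D := fun {z D t} h => by
    rwa [neg_mul, Real.exp_neg, inv_mul_le_iff₀ (Real.exp_pos _), mul_comm]
  have hval : ∀ q : Euc N × Icc (0 : ℝ) T, Real.exp (-κ * (T - (q.2 : ℝ))) *
      |Tmap N T β Γk H u Du q.1 q.2 - Tmap N T β Γk H v Dv q.1 q.2| ≤
        K * M * 1 * ((1 / κ) ^ (1 : ℝ) * Real.Gamma 1) := by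
    rintro ⟨x, t, ht⟩
    apply hunweight
    simp only [Tmap, add_sub_add_left_eq_sub]
    refine norm_potential_sub_le (μ := volume) (a := 1) (k := fun y s => Γk x t y s)
      one_pos hκ zero_le_one hKM hB0
      (hu.stronglyMeasurable_comp ht.1 hHmeas) (hv.stronglyMeasurable_comp ht.1 hHmeas)
      ?_ ?_ ?_ (fun y s hs => hfu y s (hsub ht.1 hs)) (fun y s hs => hfv y s (hsub ht.1 hs))
      (fun y s hs => hfg y s (hsub ht.1 hs))
    · exact (hΓmeas.comp ((measurable_const (a := (x, t))).prodMk (measurable_fst.prodMk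
        (measurable_subtype_coe.comp measurable_snd)))).stronglyMeasurable
    · intro s hs
      refine Integrable.of_integral_ne_zero ?_
      rw [hΓmass x t s ht.1 hs.1 hs.2]
      exact one_ne_zero
    · intro s hs
      simp only [Real.norm_of_nonneg (hΓnonneg x _ t s ht.1 hs.1 hs.2),
        hΓmass x t s ht.1 hs.1 hs.2, sub_self, Real.rpow_zero, mul_one, le_refl]
  have hgrad : ∀ q : Euc N × Icc (0 : ℝ) T, Real.exp (-κ * (T - (q.2 : ℝ))) *
      ‖DTmap N T β DΓ H u Du q.1 q.2 - DTmap N T β DΓ H v Dv q.1 q.2‖ ≤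
        K * M * (C * G) * ((1 / κ) ^ (1 / 2 : ℝ) * Real.Gamma (1 / 2)) := by
    rintro ⟨x, t, ht⟩
    apply hunweight
    simp only [DTmap, add_sub_add_left_eq_sub]
    have hmeas : Measurable fun q : Euc N × Ioc t T => DΓ x t q.1 q.2 :=
      measurable_gradient_of_forall_hasGradientAt (x := x)
        (F := fun x' (q : Euc N × Ioc t T) => Γk x' t q.1 q.2)
        (fun x' => hΓmeas.comp ((measurable_const (a := (x', t))).prodMk (measurable_fst.prodMk
          (measurable_subtype_coe.comp measurable_snd))))
        (fun q => hDΓ x q.1 t q.2 ht.1 q.2.2.1 q.2.2.2)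
    have hker : ∀ s ∈ Ioc t T, Integrable (DΓ x t · s) ∧
        ∫ y, ‖DΓ x t y s‖ ≤ C * G * (s - t) ^ ((1 / 2 : ℝ) - 1) := fun s hs =>
      integrable_and_integral_norm_le_of_gaussian_bound hc (sub_pos.2 hs.1)
        (hmeas.comp (measurable_prodMk_right
          (y := (⟨s, hs⟩ : Ioc t T)))).aestronglyMeasurable
        (fun y => hDΓbound x y t s ht.1 hs.1 hs.2)
    exact norm_potential_sub_le (μ := volume) (k := fun y s => DΓ x t y s)
      one_half_pos hκ (by positivity) hKM hB0
      (hu.stronglyMeasurable_comp ht.1 hHmeas) (hv.stronglyMeasurable_comp ht.1 hHmeas)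
      hmeas.stronglyMeasurable (fun s hs => (hker s hs).1) (fun s hs => (hker s hs).2)
      (fun y s hs => hfu y s (hsub ht.1 hs)) (fun y s hs => hfv y s (hsub ht.1 hs))
      (fun y s hs => hfg y s (hsub ht.1 hs))
  calc _ ≤ K * M * 1 * ((1 / κ) ^ (1 : ℝ) * Real.Gamma 1) +
        K * M * (C * G) * ((1 / κ) ^ (1 / 2 : ℝ) * Real.Gamma (1 / 2)) :=
        add_le_add (ciSup_le hval) (ciSup_le hgrad)
    _ = (K * (1 / κ) ^ (1 : ℝ) +
        K * (C * G) * Real.Gamma (1 / 2) * (1 / κ) ^ (1 / 2 : ℝ)) * M := by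
      rw [Real.Gamma_one]
      ring
    _ ≤ 1 / 2 * M := mul_le_mul_of_nonneg_right hκle hM0
end
end

section
/- Let K > 0 and let H : ℝ^N × ℝ × ℝ^N × [0,T] → ℝ be continuous and satisfy |H(0,0,x,t)| ≤ K for all (x,t) and H(0,u,x,t) − H(0,ū,x,t) ≤ K(u − ū) whenever u > ū. Let u : ℝ^N × [0,T] → ℝ and p : ℝ^N × [0,T] → ℝ^N be Borel measurable. Then there exist Borel measurable functions b : ℝ^N × [0,T] → ℝ^N and h, f : ℝ^N × [0,T] → ℝ such that h(x,t) ≤ K and |f(x,t)| ≤ K for all (x,t), and for all (x,t): H(p(x,t), u(x,t), x, t) = b(x,t)·p(x,t) + h(x,t)·u(x,t) + f(x,t). -/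
open scoped BigOperators
open Set

noncomputable section

/-- rewriting a semilinear Hamiltonian along given measurable
functions `u`, `p` into linear form
`H(p(x,t), u(x,t), x, t) = b(x,t)·p(x,t) + h(x,t) u(x,t) + f(x,t)` with Borel
measurable coefficients satisfying `h ≤ K` and `|f| ≤ K`. -/
theorem hamiltonian_linear_rewrite
    (N : ℕ) (hN : 1 ≤ N) (T : ℝ) (hT : 0 < T) (K : ℝ) (hK : 0 < K)
    (H : Euc N → ℝ → Euc N → ℝ → ℝ)
    (hHcont : ContinuousOn
      (fun q : Euc N × ℝ × Euc N × ℝ => H q.1 q.2.1 q.2.2.1 q.2.2.2)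
      (Set.univ ×ˢ Set.univ ×ˢ Set.univ ×ˢ Set.Icc (0:ℝ) T))
    (hH00 : ∀ (x : Euc N) (t : ℝ), t ∈ Set.Icc (0:ℝ) T → |H 0 0 x t| ≤ K)
    (hHmono : ∀ (v v' : ℝ) (x : Euc N) (t : ℝ), t ∈ Set.Icc (0:ℝ) T → v' < v →
        H 0 v x t - H 0 v' x t ≤ K * (v - v'))
    (u : Euc N → ℝ → ℝ) (p : Euc N → ℝ → Euc N)
    (humeas : Measurable (fun q : Euc N × ℝ => u q.1 q.2))
    (hpmeas : Measurable (fun q : Euc N × ℝ => p q.1 q.2)) :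
    ∃ (b : Euc N → ℝ → Euc N) (h f : Euc N → ℝ → ℝ),
      Measurable (fun q : Euc N × ℝ => b q.1 q.2) ∧
      Measurable (fun q : Euc N × ℝ => h q.1 q.2) ∧
      Measurable (fun q : Euc N × ℝ => f q.1 q.2) ∧
      ∀ (x : Euc N) (t : ℝ), t ∈ Set.Icc (0:ℝ) T →
        h x t ≤ K ∧ |f x t| ≤ K ∧
        H (p x t) (u x t) x t
          = (∑ i, b x t i * (p x t) i) + h x t * u x t + f x t := by
  have hG : Continuous (fun q : Euc N × ℝ × Euc N × ℝ =>
      H q.1 q.2.1 q.2.2.1 (max 0 (min T q.2.2.2))) :=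
    hHcont.comp_continuous
      (f := fun q : Euc N × ℝ × Euc N × ℝ => (q.1, q.2.1, q.2.2.1, max 0 (min T q.2.2.2)))
      (by fun_prop)
      (fun q => ⟨trivial, trivial, trivial, le_max_left _ _, max_le hT.le (min_le_left _ _)⟩)
  have hGmeas : ∀ (P : Euc N × ℝ → Euc N) (v : Euc N × ℝ → ℝ), Measurable P → Measurable v →
      Measurable (fun q : Euc N × ℝ => H (P q) (v q) q.1 (max 0 (min T q.2))) :=
    fun P v hP hv =>
      hG.measurable.comp (hP.prodMk (hv.prodMk (measurable_fst.prodMk measurable_snd)))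
  have hGpu := hGmeas _ _ hpmeas humeas
  have hG0u := hGmeas _ _ (measurable_const (a := (0 : Euc N))) humeas
  have hG00 := hGmeas _ _ (measurable_const (a := (0 : Euc N))) (measurable_const (a := (0 : ℝ)))
  refine ⟨fun x t => ((H (p x t) (u x t) x (max 0 (min T t))
        - H 0 (u x t) x (max 0 (min T t))) / ‖p x t‖ ^ 2) • p x t,
    fun x t => (H 0 (u x t) x (max 0 (min T t)) - H 0 0 x (max 0 (min T t))) / u x t,
    fun x t => H 0 0 x (max 0 (min T t)),
    ((hGpu.sub hG0u).div (hpmeas.norm.pow_const 2)).smul hpmeas,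
    (hG0u.sub hG00).div humeas, hG00, fun x t ht => ?_⟩
  have hclamp : max 0 (min T t) = t := by rw [min_eq_right ht.2, max_eq_right ht.1]
  simp only [hclamp, PiLp.smul_apply, smul_eq_mul]
  refine ⟨?_, hH00 x t ht, ?_⟩
  · rcases lt_trichotomy (u x t) 0 with hu | hu | hu
    · rw [div_le_iff_of_neg hu]
      linarith [hHmono 0 (u x t) x t ht hu]
    · simpa [hu] using hK.le
    · rw [div_le_iff₀ hu]
      linarith [hHmono (u x t) 0 x t ht hu]
  · have hsum : ∑ i, (H (p x t) (u x t) x t - H 0 (u x t) x t) / ‖p x t‖ ^ 2 * p x t i * p x t i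
        = H (p x t) (u x t) x t - H 0 (u x t) x t := by
      simp only [mul_assoc, ← Finset.mul_sum, ← sq]
      rw [← EuclideanSpace.real_norm_sq_eq]
      exact div_mul_cancel_of_imp fun hp => by
        rw [norm_eq_zero.mp (pow_eq_zero_iff two_ne_zero |>.mp hp), sub_self]
    have hquot : (H 0 (u x t) x t - H 0 0 x t) / u x t * u x t
        = H 0 (u x t) x t - H 0 0 x t :=
      div_mul_cancel_of_imp fun hu => by rw [hu, sub_self]
    rw [hsum, hquot]
    ring
end
end
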